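/- For every positive integer n there exists a positive integer N = N(n) such that every finite digraph with a haven of order at least N has a 6-eulerianizable subdigraph which has a haven of order at least n. -/

import Mathlib

/-- A directed path in the digraph with adjacency relation `A`: a nonempty list of
distinct vertices in which each consecutive pair is joined by an edge directed forwards. -/
def IsDipath {V : Type*} (A : V → V → Prop) (l : List V) : Prop :=
  l ≠ [] ∧ l.Nodup ∧ l.Chain' A

/-- A directed path all of whose vertices lie in the set `S`. -/
def DipathIn {V : Type*} (A : V → V → Prop) (S : Set V) (l : List V) : Prop :=
  IsDipath A l ∧ ∀ v ∈ l, v ∈ S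

/-- A directed path from `u` to `v`. -/
def DipathFromTo {V : Type*} (A : V → V → Prop) (l : List V) (u v : V) : Prop :=
  IsDipath A l ∧ l.head? = some u ∧ l.getLast? = some v

/-- The digraph with adjacency `A` is strongly connected on the vertex set `S`:
any vertex of `S` can reach any other by a directed path staying inside `S`. -/
def StrongOn {V : Type*} (A : V → V → Prop) (S : Set V) : Prop :=
  ∀ u ∈ S, ∀ v ∈ S, ∃ l : List V, DipathIn A S l ∧ l.head? = some u ∧ l.getLast? = some v

/-- `C` is (the vertex set of) a strong component of the subdigraph induced on `W`:
a maximal nonempty strongly connected subset of `W`. -/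
def IsStrongComponent {V : Type*} (A : V → V → Prop) (W C : Set V) : Prop :=
  C ⊆ W ∧ C.Nonempty ∧ StrongOn A C ∧
    ∀ C' : Set V, C ⊆ C' → C' ⊆ W → StrongOn A C' → C' = C

/-- `B` is a haven of order `w` in the digraph with adjacency `A` and vertex set `S`:
for every `Z ⊆ S` with `|Z| < w`, `B Z` is a strong component of the digraph minus `Z`,
and `B Z ⊆ B Z'` whenever `Z' ⊆ Z` (the haven axiom). -/
def IsHavenOn {V : Type*} (A : V → V → Prop) (S : Set V) (w : ℕ) (B : Finset V → Set V) : Prop :=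
  ∀ Z : Finset V, ↑Z ⊆ S → Z.card < w →
    IsStrongComponent A (S \ ↑Z) (B Z) ∧ ∀ Z' : Finset V, Z' ⊆ Z → B Z ⊆ B Z'

/-- The digraph with adjacency `A` and vertex set `S` has a haven of order `w`. -/
def HasHavenOn {V : Type*} (A : V → V → Prop) (S : Set V) (w : ℕ) : Prop :=
  ∃ B : Finset V → Set V, IsHavenOn A S w B

/-- The digraph with adjacency `A` (on its whole vertex type) has a haven of order `w`. -/
def HasHaven {V : Type*} (A : V → V → Prop) (w : ℕ) : Prop :=
  HasHavenOn A Set.univ w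

/-- A linkage from the finite set `S` to the finite set `T`: for each `a ∈ S`,
`P a` is a directed path from `a` to `τ a ∈ T`, and the paths are pairwise vertex-disjoint
(so the ends `τ a` are distinct vertices of `T`). -/
def IsLinkage {V : Type*} (A : V → V → Prop) (S T : Finset V)
    (P : V → List V) (τ : V → V) : Prop :=
  (∀ a ∈ S, τ a ∈ T ∧ DipathFromTo A (P a) a (τ a)) ∧
  ∀ a₁ ∈ S, ∀ a₂ ∈ S, a₁ ≠ a₂ → ∀ v ∈ P a₁, v ∉ P a₂

/-- `X` is linked: for every `S, T ⊆ X` with `|S| = |T|` there is a linkage of `|S|`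
pairwise vertex-disjoint directed paths from `S` to `T`. -/
def Linked {V : Type*} (A : V → V → Prop) (X : Finset V) : Prop :=
  ∀ S T : Finset V, S ⊆ X → T ⊆ X → S.card = T.card →
    ∃ (P : V → List V) (τ : V → V), IsLinkage A S T P τ

/-- `(S, A')` is a subdigraph of the digraph with adjacency `A`: every edge of `A'`
is an edge of `A` with both ends in `S`. -/
def IsSubdigraph {V : Type*} (A : V → V → Prop) (S : Set V) (A' : V → V → Prop) : Prop :=
  ∀ u v, A' u v → A u v ∧ u ∈ S ∧ v ∈ S

/-- The digraph with adjacency `A` and vertex set `S` is `k`-eulerianizable: it is strongly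
connected and one can assign a positive multiplicity to each edge so that at every vertex the
total multiplicity of in-edges equals that of the out-edges and both are at most `k`. -/
def Eulerianizable {V : Type*} [Fintype V] (A : V → V → Prop) (S : Set V) (k : ℕ) : Prop :=
  StrongOn A S ∧ ∃ m : V → V → ℕ,
    (∀ u v, A u v → 1 ≤ m u v) ∧ (∀ u v, ¬ A u v → m u v = 0) ∧
    ∀ v ∈ S, (∑ u, m u v) = (∑ u, m v u) ∧ (∑ u, m v u) ≤ k

/-- `v` can be reached from `u` by steps of `A` between vertices of `W`. -/
def ReachIn {V : Type*} (A : V → V → Prop) (W : Set V) : V → V → Prop :=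
  Relation.ReflTransGen fun u v => A u v ∧ u ∈ W ∧ v ∈ W

namespace ReachIn

variable {V : Type*} {A : V → V → Prop} {W W' : Set V} {u v w : V}

theorem refl (u : V) : ReachIn A W u u := Relation.ReflTransGen.refl

theorem trans (h : ReachIn A W u v) (h' : ReachIn A W v w) : ReachIn A W u w :=
  Relation.ReflTransGen.trans h h'

theorem mono (hW : W ⊆ W') (h : ReachIn A W u v) : ReachIn A W' u v :=
  Relation.ReflTransGen.mono (fun _ _ h => ⟨h.1, hW h.2.1, hW h.2.2⟩) _ _ h

theorem mem (h : ReachIn A W u v) (hu : u ∈ W) : v ∈ W := by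
  induction h with
  | refl => exact hu
  | tail _ h _ => exact h.2.2

theorem exists_dipath (h : ReachIn A W u v) (hu : u ∈ W) :
    ∃ l, DipathIn A W l ∧ l.head? = some u ∧ l.getLast? = some v := by
  induction h using Relation.ReflTransGen.head_induction_on with
  | refl => exact ⟨[v], ⟨⟨by simp, by simp, List.isChain_singleton v⟩, by simpa using hu⟩, rfl, rfl⟩
  | @head a c hac hcv ih =>
    obtain ⟨l, ⟨⟨hne, hnd, hch⟩, hW⟩, hh, hl⟩ := ih hac.2.2
    by_cases ha : a ∈ l
    · obtain ⟨s, t, rfl⟩ := List.append_of_mem ha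
      refine ⟨a :: t, ⟨⟨by simp, (List.nodup_append.1 hnd).2.1,
        (List.isChain_append.1 hch).2.1⟩, fun x hx => hW x (by simp at hx ⊢; tauto)⟩, by simp, ?_⟩
      rwa [List.getLast?_append_of_ne_nil _ (by simp)] at hl
    · refine ⟨a :: l, ⟨⟨by simp, List.nodup_cons.2 ⟨ha, hnd⟩, ?_⟩, ?_⟩, by simp, ?_⟩
      · refine List.isChain_cons.2 ⟨?_, hch⟩
        rintro y hy
        rw [hh] at hy
        obtain rfl : c = y := by simpa using hy
        exact hac.1
      · rintro x hx
        rcases List.mem_cons.1 hx with rfl | hx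
        · exact hu
        · exact hW x hx
      · obtain ⟨b, l', rfl⟩ := List.exists_cons_of_ne_nil hne
        rwa [List.getLast?_cons_cons]

theorem of_list {l : List V} (hch : l.IsChain A) (hW : ∀ x ∈ l, x ∈ W)
    (hh : l.head? = some u) (hl : l.getLast? = some v) : ReachIn A W u v := by
  induction l generalizing u with
  | nil => simp at hh
  | cons a l ih =>
    obtain rfl : a = u := by simpa using hh
    rcases l with _ | ⟨b, l⟩
    · obtain rfl : a = v := by simpa using hl
      exact refl _
    · rw [List.getLast?_cons_cons] at hl
      rw [List.isChain_cons_cons] at hch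
      exact Relation.ReflTransGen.head ⟨hch.1, hW _ (by simp), hW _ (by simp)⟩
        (ih hch.2 (fun x hx => hW x (List.mem_cons_of_mem _ hx)) (by simp) hl)

theorem of_strongOn (h : StrongOn A W) (hu : u ∈ W) (hv : v ∈ W) : ReachIn A W u v := by
  obtain ⟨l, ⟨⟨_, _, hch⟩, hW⟩, hh, hl⟩ := h u hu v hv
  exact of_list hch hW hh hl

/-- The vertices mutually reachable with `u` inside `W` form a strong component of `W`. -/
theorem isStrongComponent (hu : u ∈ W) :
    IsStrongComponent A W {x | ReachIn A W u x ∧ ReachIn A W x u} := by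
  have key : ∀ x, ReachIn A W u x → ReachIn A W x u →
      ReachIn A {x | ReachIn A W u x ∧ ReachIn A W x u} u x ∧
      ReachIn A {x | ReachIn A W u x ∧ ReachIn A W x u} x u := by
    intro x h1 h2
    constructor
    · induction h1 with
      | refl => exact refl _
      | @tail b c hb hbc ih =>
        have hbu : ReachIn A W b u := Relation.ReflTransGen.head hbc h2
        exact (ih hbu).tail ⟨hbc.1, ⟨hb, hbu⟩, ⟨hb.tail hbc, h2⟩⟩
    · induction h2 using Relation.ReflTransGen.head_induction_on with
      | refl => exact refl _
      | @head a c hac hcu ih =>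
        have huc : ReachIn A W u c := h1.tail hac
        exact (ih huc).head ⟨hac.1, ⟨h1, hcu.head hac⟩, ⟨huc, hcu⟩⟩
  refine ⟨fun x hx => hx.1.mem hu, ⟨u, refl u, refl u⟩, ?_, ?_⟩
  · intro x hx y hy
    exact ((key x hx.1 hx.2).2.trans (key y hy.1 hy.2).1).exists_dipath hx
  · intro C' hC hC' hs
    refine Set.Subset.antisymm (fun x hx => ?_) hC
    have hu' : u ∈ C' := hC ⟨refl u, refl u⟩
    exact ⟨(of_strongOn hs hu' hx).mono hC', (of_strongOn hs hx hu').mono hC'⟩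

end ReachIn

/-- A directed path, presented by its length and its sequence of vertices. -/
structure DPath {V : Type*} (A : V → V → Prop) where
  /-- The number of edges. -/
  len : ℕ
  /-- The vertices; only those of index at most `len` matter. -/
  pt : ℕ → V
  adj : ∀ i < len, A (pt i) (pt (i + 1))
  inj : ∀ i ≤ len, ∀ j ≤ len, pt i = pt j → i = j

namespace DPath

variable {V : Type*} {A : V → V → Prop}

/-- The first vertex of a path. -/
def first (q : DPath A) : V := q.pt 0

/-- The last vertex of a path. -/
def last (q : DPath A) : V := q.pt q.len

/-- The vertex set of a path. -/
def verts (q : DPath A) : Set V := {v | ∃ i ≤ q.len, q.pt i = v}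

theorem first_mem (q : DPath A) : q.first ∈ q.verts := ⟨0, Nat.zero_le _, rfl⟩

theorem last_mem (q : DPath A) : q.last ∈ q.verts := ⟨q.len, le_rfl, rfl⟩

/-- The relation `E` contains all edges of the path `q`. -/
def EdgesIn (q : DPath A) (E : V → V → Prop) : Prop :=
  ∀ i < q.len, E (q.pt i) (q.pt (i + 1))

variable {E : V → V → Prop} {q : DPath A}

theorem EdgesIn.reach (h : q.EdgesIn E) {i j : ℕ} (hij : i ≤ j) (hj : j ≤ q.len) :
    ReachIn E q.verts (q.pt i) (q.pt j) := by
  induction j, hij using Nat.le_induction with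
  | base => exact ReachIn.refl _
  | succ j hij ih =>
    exact (ih (by omega)).tail ⟨h j (by omega), ⟨j, by omega, rfl⟩, ⟨j + 1, hj, rfl⟩⟩

theorem EdgesIn.reach_first (h : q.EdgesIn E) {x : V} (hx : x ∈ q.verts) :
    ReachIn E q.verts q.first x := by
  obtain ⟨i, hi, rfl⟩ := hx
  exact h.reach (Nat.zero_le i) hi

theorem EdgesIn.reach_last (h : q.EdgesIn E) {x : V} (hx : x ∈ q.verts) :
    ReachIn E q.verts x q.last := by
  obtain ⟨i, hi, rfl⟩ := hx
  exact h.reach hi le_rfl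

/-- The part of a path between the positions `i ≤ j`. -/
def slice (q : DPath A) (i j : ℕ) (hij : i ≤ j) (hj : j ≤ q.len) : DPath A where
  len := j - i
  pt t := q.pt (i + t)
  adj t ht := q.adj (i + t) (by omega)
  inj s hs t ht h := by
    have := q.inj _ (by omega) _ (by omega) h
    omega

theorem slice_first {i j : ℕ} (hij : i ≤ j) (hj : j ≤ q.len) :
    (q.slice i j hij hj).first = q.pt i := rfl

theorem slice_last {i j : ℕ} (hij : i ≤ j) (hj : j ≤ q.len) :
    (q.slice i j hij hj).last = q.pt j := by
  simp [slice, last, Nat.add_sub_cancel' hij]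

theorem mem_slice {i j : ℕ} (hij : i ≤ j) (hj : j ≤ q.len) {v : V} :
    v ∈ (q.slice i j hij hj).verts ↔ ∃ t, i ≤ t ∧ t ≤ j ∧ q.pt t = v := by
  constructor
  · rintro ⟨t, ht, rfl⟩
    exact ⟨i + t, by omega, by simp only [slice] at ht; omega, rfl⟩
  · rintro ⟨t, h1, h2, rfl⟩
    exact ⟨t - i, by simp only [slice]; omega, by simp [slice, Nat.add_sub_cancel' h1]⟩

/-- The number of times an edge of the path `q` leaves the vertex `v`. -/
def visits [DecidableEq V] (q : DPath A) (v : V) : ℕ :=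
  ∑ i ∈ Finset.range q.len, if q.pt i = v then 1 else 0

/-- The multiplicity of the pair `(u, v)` as an edge of the path `q`. -/
def mult [DecidableEq V] (q : DPath A) (u v : V) : ℕ :=
  ∑ i ∈ Finset.range q.len, if q.pt i = u ∧ q.pt (i + 1) = v then 1 else 0

section
variable [DecidableEq V]

theorem sum_mult_right [Fintype V] (q : DPath A) (u : V) : ∑ v, q.mult u v = q.visits u := by
  simp only [mult, visits]
  rw [Finset.sum_comm]
  refine Finset.sum_congr rfl fun i _ => ?_
  by_cases h : q.pt i = u <;> simp [h]

theorem sum_mult_left [Fintype V] (q : DPath A) (v : V) :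
    ∑ u, q.mult u v + (if q.first = v then 1 else 0) =
      q.visits v + if q.last = v then 1 else 0 := by
  have : ∑ u, q.mult u v =
      ∑ i ∈ Finset.range q.len, if q.pt (i + 1) = v then 1 else 0 := by
    simp only [mult]
    rw [Finset.sum_comm]
    refine Finset.sum_congr rfl fun i _ => ?_
    by_cases h : q.pt (i + 1) = v <;> simp [h]
  rw [this, visits, first, last, ← Finset.sum_range_succ,
    Finset.sum_range_succ' fun i => if q.pt i = v then 1 else 0]

theorem mult_pos {u v : V} : 1 ≤ q.mult u v ↔ ∃ i < q.len, q.pt i = u ∧ q.pt (i + 1) = v := by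
  rw [Nat.one_le_iff_ne_zero, mult, Ne, Finset.sum_eq_zero_iff]
  simp

theorem visits_eq_zero {v : V} (h : v ∉ q.verts) : q.visits v = 0 := by
  refine Finset.sum_eq_zero fun i hi => if_neg fun hv => h ⟨i, ?_, hv⟩
  exact (Finset.mem_range.1 hi).le

theorem visits_le_one (q : DPath A) (v : V) : q.visits v ≤ 1 := by
  rw [visits, ← Finset.card_filter]
  refine Finset.card_le_one.2 fun i hi j hj => ?_
  simp only [Finset.mem_filter, Finset.mem_range] at hi hj
  exact q.inj i hi.1.le j hj.1.le (hi.2.trans hj.2.symm)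

theorem sum_visits_le_one {ι : Type*} [Fintype ι] {l : ι → DPath A}
    (hl : Pairwise fun i j => Disjoint (l i).verts (l j).verts) (v : V) :
    ∑ i, (l i).visits v ≤ 1 := by
  by_cases h : ∃ i, v ∈ (l i).verts
  · obtain ⟨i, hi⟩ := h
    rw [Finset.sum_eq_single i]
    · exact visits_le_one _ _
    · exact fun j _ hji => visits_eq_zero fun hj => Set.disjoint_left.1 (hl hji) hj hi
    · simp
  · push Not at h
    simp [fun i => visits_eq_zero (h i)]

end

end DPath

/-- A cyclic arrangement of paths: `r i` leads from the end of `l i` to the start of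
`l (next i)`, the paths `l i` are pairwise disjoint, and so are the paths `r i`. -/
structure LinkRing {V : Type*} (A : V → V → Prop) (ι : Type*) where
  /-- The main paths. -/
  l : ι → DPath A
  /-- The connecting paths. -/
  r : ι → DPath A
  /-- The cyclic order. -/
  next : Equiv.Perm ι
  l_last : ∀ i, (l i).last = (r i).first
  r_last : ∀ i, (r i).last = (l (next i)).first
  l_disj : Pairwise fun i j => Disjoint (l i).verts (l j).verts
  r_disj : Pairwise fun i j => Disjoint (r i).verts (r j).verts

namespace LinkRing

variable {V ι κ : Type*} {A : V → V → Prop}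

/-- The vertex where `l i` ends and `r i` starts. -/
def mark (R : LinkRing A ι) (i : ι) : V := (l R i).last

/-- The relation `E` contains all edges of the ring. -/
def EdgesIn (R : LinkRing A ι) (E : V → V → Prop) : Prop :=
  ∀ i, (R.l i).EdgesIn E ∧ (R.r i).EdgesIn E

/-- The vertices of the ring. -/
def verts (R : LinkRing A ι) : Set V := {v | ∃ i, v ∈ (R.l i).verts ∨ v ∈ (R.r i).verts}

variable {R : LinkRing A ι} {C : LinkRing A κ} {E : V → V → Prop}

theorem mark_mem_verts (i : ι) : R.mark i ∈ R.verts := ⟨i, Or.inl (R.l i).last_mem⟩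

theorem EdgesIn.reach_next (h : R.EdgesIn E) {i : ι} {x : V} (hx : x ∈ (R.l (R.next i)).verts) :
    ReachIn E ((R.r i).verts ∪ (R.l (R.next i)).verts) (R.mark i) x := by
  have h1 := (h i).2.reach_last (R.r i).first_mem
  rw [← R.l_last, R.r_last] at h1
  exact (h1.mono Set.subset_union_left).trans
    (((h _).1.reach_first hx).mono Set.subset_union_right)

theorem EdgesIn.reach_mark_next (h : R.EdgesIn E) (i : ι) :
    ReachIn E ((R.r i).verts ∪ (R.l (R.next i)).verts) (R.mark i) (R.mark (R.next i)) :=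
  h.reach_next (R.l _).last_mem

theorem EdgesIn.reach_cross (hR : R.EdgesIn E) (hC : C.EdgesIn E) {i : ι} {j : κ}
    (hx : ((R.l (R.next i)).verts ∩ (C.l j).verts).Nonempty) :
    ReachIn E ((R.r i).verts ∪ (R.l (R.next i)).verts ∪ (C.l j).verts) (R.mark i) (C.mark j) := by
  obtain ⟨x, hx, hx'⟩ := hx
  exact ((hR.reach_next hx).mono Set.subset_union_left).trans
    (((hC j).1.reach_last hx').mono Set.subset_union_right)

/-- Each vertex of the ring lies between two marks. -/
theorem EdgesIn.between (h : R.EdgesIn E) {x : V} (hx : x ∈ R.verts) :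
    (∃ i, ReachIn E Set.univ (R.mark i) x) ∧ ∃ i, ReachIn E Set.univ x (R.mark i) := by
  obtain ⟨i, hx | hx⟩ := hx
  · obtain ⟨j, rfl⟩ := R.next.surjective i
    exact ⟨⟨j, (h.reach_next hx).mono (Set.subset_univ _)⟩,
      ⟨_, ((h _).1.reach_last hx).mono (Set.subset_univ _)⟩⟩
  · refine ⟨⟨i, ?_⟩, ⟨R.next i, ?_⟩⟩
    · rw [mark, R.l_last]
      exact ((h i).2.reach_first hx).mono (Set.subset_univ _)
    · have h1 := (h i).2.reach_last hx
      rw [R.r_last] at h1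
      exact (h1.mono (Set.subset_univ _)).trans
        (((h _).1.reach_last (R.l _).first_mem).mono (Set.subset_univ _))

section
variable [Fintype ι] [DecidableEq V]

/-- The total multiplicity of the pair `(u, v)` as an edge of the ring. -/
def mult (R : LinkRing A ι) (u v : V) : ℕ := ∑ i, ((R.l i).mult u v + (R.r i).mult u v)

theorem mult_pos {u v : V} : 1 ≤ R.mult u v ↔
    ∃ i, 1 ≤ (R.l i).mult u v ∨ 1 ≤ (R.r i).mult u v := by
  rw [Nat.one_le_iff_ne_zero, mult, Ne, Finset.sum_eq_zero_iff]
  simp only [Finset.mem_univ, true_imp_iff, not_forall]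
  exact exists_congr fun i => by omega

theorem edgesIn_mult : R.EdgesIn fun u v => 1 ≤ R.mult u v := fun i =>
  ⟨fun t ht => mult_pos.2 ⟨i, Or.inl (DPath.mult_pos.2 ⟨t, ht, rfl, rfl⟩)⟩,
    fun t ht => mult_pos.2 ⟨i, Or.inr (DPath.mult_pos.2 ⟨t, ht, rfl, rfl⟩)⟩⟩

theorem edge_of_mult_pos {u v : V} (h : 1 ≤ R.mult u v) : A u v ∧ u ∈ R.verts ∧ v ∈ R.verts := by
  obtain ⟨i, h | h⟩ := mult_pos.1 h
  · obtain ⟨t, ht, rfl, rfl⟩ := DPath.mult_pos.1 h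
    exact ⟨(R.l i).adj t ht, ⟨i, Or.inl ⟨t, ht.le, rfl⟩⟩, ⟨i, Or.inl ⟨t + 1, ht, rfl⟩⟩⟩
  · obtain ⟨t, ht, rfl, rfl⟩ := DPath.mult_pos.1 h
    exact ⟨(R.r i).adj t ht, ⟨i, Or.inr ⟨t, ht.le, rfl⟩⟩, ⟨i, Or.inr ⟨t + 1, ht, rfl⟩⟩⟩

theorem sum_mult_right [Fintype V] (R : LinkRing A ι) (u : V) :
    ∑ v, R.mult u v = ∑ i, (R.l i).visits u + ∑ i, (R.r i).visits u := by
  simp only [mult]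
  rw [Finset.sum_comm, ← Finset.sum_add_distrib]
  refine Finset.sum_congr rfl fun i _ => ?_
  rw [Finset.sum_add_distrib, DPath.sum_mult_right, DPath.sum_mult_right]

theorem sum_mult_right_le [Fintype V] (R : LinkRing A ι) (u : V) : ∑ v, R.mult u v ≤ 2 := by
  rw [sum_mult_right]
  exact Nat.add_le_add (DPath.sum_visits_le_one R.l_disj u) (DPath.sum_visits_le_one R.r_disj u)

theorem sum_mult_left [Fintype V] (R : LinkRing A ι) (v : V) :
    ∑ u, R.mult u v = ∑ u, R.mult v u := by
  have hl : ∑ u, R.mult u v = ∑ i, (∑ u, (R.l i).mult u v + ∑ u, (R.r i).mult u v) := by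
    simp only [mult]
    rw [Finset.sum_comm]
    exact Finset.sum_congr rfl fun i _ => Finset.sum_add_distrib
  have key : ∑ i, (∑ u, (R.l i).mult u v + ∑ u, (R.r i).mult u v +
      ((if (R.l i).first = v then 1 else 0) + if (R.r i).first = v then 1 else 0)) =
      ∑ i, ((R.l i).visits v + (R.r i).visits v +
      ((if (R.l (R.next i)).first = v then 1 else 0) + if (R.r i).first = v then 1 else 0)) := by
    refine Finset.sum_congr rfl fun i _ => ?_
    have h1 := (R.l i).sum_mult_left v
    have h2 := (R.r i).sum_mult_left v
    rw [R.l_last] at h1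
    rw [R.r_last] at h2
    omega
  have hperm : ∑ i, (if (R.l (R.next i)).first = v then 1 else 0) =
      ∑ i, if (R.l i).first = v then 1 else 0 :=
    Equiv.sum_comp R.next fun i => if (R.l i).first = v then 1 else 0
  rw [hl, sum_mult_right]
  simp only [Finset.sum_add_distrib] at key hperm ⊢
  omega

end

/-- Two rings with many pairs of crossing parts form a subdigraph as required. -/
theorem exists_eulerianizable [Fintype V] [DecidableEq V] [Fintype ι] [Fintype κ] {I J : Type*}
    {n : ℕ} (hn : 0 < n) (R : LinkRing A ι) (C : LinkRing A κ)
    (ρ : I → ι) (σ : J → κ) (F : I → Set V) (G : J → Set V)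
    (hF : ∀ Z : Finset V, Z.card < n → ∃ i, Disjoint (F i) ↑Z)
    (hG : ∀ Z : Finset V, Z.card < n → ∃ j, Disjoint (G j) ↑Z)
    (hρ : ∀ i, R.mark (ρ i) ∈ F i)
    (hRC : ∀ E, R.EdgesIn E → C.EdgesIn E → ∀ i j,
      ReachIn E (F i ∪ G j) (R.mark (ρ i)) (C.mark (σ j)) ∧
      ReachIn E (F i ∪ G j) (C.mark (σ j)) (R.mark (ρ i)))
    (hR : ∀ E, R.EdgesIn E → ∀ v, ∃ i, ReachIn E Set.univ (R.mark v) (R.mark (ρ i)) ∧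
      ReachIn E Set.univ (R.mark (ρ i)) (R.mark v))
    (hC : ∀ E, C.EdgesIn E → ∀ w, ∃ j, ReachIn E Set.univ (C.mark w) (C.mark (σ j)) ∧
      ReachIn E Set.univ (C.mark (σ j)) (C.mark w)) :
    ∃ (S : Set V) (A' : V → V → Prop),
      IsSubdigraph A S A' ∧ Eulerianizable A' S 6 ∧ ∃ w, n ≤ w ∧ HasHavenOn A' S w := by
  set E : V → V → Prop := fun u v => 1 ≤ R.mult u v + C.mult u v with hE
  set S : Set V := R.verts ∪ C.verts with hS
  have hER : R.EdgesIn E := fun i =>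
    ⟨fun t ht => le_add_right ((edgesIn_mult i).1 t ht),
      fun t ht => le_add_right ((edgesIn_mult i).2 t ht)⟩
  have hEC : C.EdgesIn E := fun i =>
    ⟨fun t ht => le_add_left ((edgesIn_mult i).1 t ht),
      fun t ht => le_add_left ((edgesIn_mult i).2 t ht)⟩
  have hsub : IsSubdigraph A S E := by
    intro u v huv
    rcases (show 1 ≤ R.mult u v ∨ 1 ≤ C.mult u v by simp only [hE] at huv; omega) with h | h
    · obtain ⟨h1, h2, h3⟩ := edge_of_mult_pos h
      exact ⟨h1, Or.inl h2, Or.inl h3⟩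
    · obtain ⟨h1, h2, h3⟩ := edge_of_mult_pos h
      exact ⟨h1, Or.inr h2, Or.inr h3⟩
  have restrict : ∀ {W : Set V} {u v : V}, ReachIn E W u v → ReachIn E (S ∩ W) u v :=
    fun h => Relation.ReflTransGen.mono
      (fun _ _ h => ⟨h.1, ⟨(hsub _ _ h.1).2.1, h.2.1⟩, ⟨(hsub _ _ h.1).2.2, h.2.2⟩⟩) _ _ h
  obtain ⟨i₀, -⟩ := hF ∅ (by simpa using hn)
  obtain ⟨j₀, -⟩ := hG ∅ (by simpa using hn)
  have cross : ∀ i j, ReachIn E Set.univ (R.mark (ρ i)) (C.mark (σ j)) ∧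
      ReachIn E Set.univ (C.mark (σ j)) (R.mark (ρ i)) := fun i j =>
    ⟨(hRC E hER hEC i j).1.mono (Set.subset_univ _), (hRC E hER hEC i j).2.mono (Set.subset_univ _)⟩
  have toR : ∀ v, ReachIn E Set.univ (R.mark v) (R.mark (ρ i₀)) ∧
      ReachIn E Set.univ (R.mark (ρ i₀)) (R.mark v) := by
    intro v
    obtain ⟨i, h1, h2⟩ := hR E hER v
    exact ⟨h1.trans ((cross i j₀).1.trans (cross i₀ j₀).2),
      ((cross i₀ j₀).1.trans (cross i j₀).2).trans h2⟩
  have toC : ∀ w, ReachIn E Set.univ (C.mark w) (R.mark (ρ i₀)) ∧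
      ReachIn E Set.univ (R.mark (ρ i₀)) (C.mark w) := by
    intro w
    obtain ⟨j, h1, h2⟩ := hC E hEC w
    exact ⟨h1.trans (cross i₀ j).2, (cross i₀ j).1.trans h2⟩
  have all : ∀ x ∈ S, ReachIn E Set.univ x (R.mark (ρ i₀)) ∧
      ReachIn E Set.univ (R.mark (ρ i₀)) x := by
    rintro x (hx | hx)
    · obtain ⟨⟨i, hi⟩, ⟨j, hj⟩⟩ := hER.between hx
      exact ⟨hj.trans (toR j).1, (toR i).2.trans hi⟩
    · obtain ⟨⟨i, hi⟩, ⟨j, hj⟩⟩ := hEC.between hx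
      exact ⟨hj.trans (toC j).1, (toC i).2.trans hi⟩
  refine ⟨S, E, hsub, ⟨?_, fun u v => R.mult u v + C.mult u v, ?_, ?_, ?_⟩, n, le_rfl, ?_⟩
  · intro u hu v hv
    exact ((restrict ((all u hu).1.trans (all v hv).2)).mono Set.inter_subset_left).exists_dipath hu
  · exact fun u v h => h
  · exact fun u v h => Nat.eq_zero_of_not_pos h
  · intro v _
    have h1 := R.sum_mult_right_le v
    have h2 := C.sum_mult_right_le v
    simp only [Finset.sum_add_distrib, R.sum_mult_left, C.sum_mult_left]
    exact ⟨trivial, by omega⟩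
  · refine ⟨fun Z => {x | ∃ i j, Disjoint (F i) ↑Z ∧ Disjoint (G j) ↑Z ∧
      ReachIn E (S \ ↑Z) (R.mark (ρ i)) x ∧ ReachIn E (S \ ↑Z) x (R.mark (ρ i))}, ?_⟩
    intro Z _ hZ
    constructor
    · obtain ⟨i, hi⟩ := hF Z hZ
      obtain ⟨j, hj⟩ := hG Z hZ
      have good : ∀ i j, Disjoint (F i) (Z : Set V) → Disjoint (G j) (Z : Set V) →
          ReachIn E (S \ ↑Z) (R.mark (ρ i)) (C.mark (σ j)) ∧
          ReachIn E (S \ ↑Z) (C.mark (σ j)) (R.mark (ρ i)) := by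
        intro i j hi hj
        have hd : S ∩ (F i ∪ G j) ⊆ S \ ↑Z := fun x hx =>
          ⟨hx.1, Set.disjoint_left.1 (Set.disjoint_union_left.2 ⟨hi, hj⟩) hx.2⟩
        exact ⟨(restrict (hRC E hER hEC i j).1).mono hd, (restrict (hRC E hER hEC i j).2).mono hd⟩
      have hmem : R.mark (ρ i) ∈ S \ ↑Z :=
        ⟨Or.inl (mark_mem_verts _), Set.disjoint_left.1 hi (hρ i)⟩
      convert ReachIn.isStrongComponent (A := E) hmem using 1
      ext x
      constructor
      · rintro ⟨i', j', hi', hj', h1, h2⟩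
        exact ⟨((good i j hi hj).1.trans (good i' j hi' hj).2).trans h1,
          h2.trans ((good i' j hi' hj).1.trans (good i j hi hj).2)⟩
      · rintro ⟨h1, h2⟩
        exact ⟨i, j, hi, hj, h1, h2⟩
    · rintro Z' hZ' x ⟨i, j, hi, hj, h1, h2⟩
      have hc : (Z' : Set V) ⊆ ↑Z := by exact_mod_cast hZ'
      have hd : S \ (Z : Set V) ⊆ S \ ↑Z' := Set.sdiff_subset_sdiff_right hc
      exact ⟨i, j, hi.mono_right hc, hj.mono_right hc, h1.mono hd, h2.mono hd⟩

end LinkRing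

theorem iterate_eq_iterate {V : Type*} {Y T : Finset V} {f : V → V}
    (hinj : ∀ u ∉ T, ∀ v ∉ T, f u = f v → u = v) (hY : ∀ v ∉ T, f v ∉ Y) {y y' : V}
    (hy : y ∈ Y) (hy' : y' ∈ Y) {a b : ℕ} (ha : ∀ i < a, f^[i] y ∉ T)
    (hb : ∀ i < b, f^[i] y' ∉ T) (h : f^[a] y = f^[b] y') : a = b ∧ y = y' := by
  induction a generalizing b with
  | zero =>
    rcases b with _ | b
    · exact ⟨rfl, h⟩
    · rw [Function.iterate_succ_apply'] at h
      exact absurd (h ▸ hy : f (f^[b] y') ∈ Y) (hY _ (hb b (by omega)))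
  | succ a ih =>
    rcases b with _ | b
    · rw [Function.iterate_succ_apply'] at h
      exact absurd (h ▸ hy' : f (f^[a] y) ∈ Y) (hY _ (ha a (by omega)))
    · rw [Function.iterate_succ_apply', Function.iterate_succ_apply'] at h
      have := ih (fun i hi => ha i (by omega)) (fun i hi => hb i (by omega))
        (hinj _ (ha a (by omega)) _ (hb b (by omega)) h)
      exact ⟨by omega, this.2⟩

section Menger

variable {V : Type*} [Fintype V] {A : V → V → Prop}

/-- If no set of fewer than `|Y|` vertices separates `Y` from `T`, then the vertices outside `T`
can be moved injectively along edges, or left in place, so as to avoid `Y`. -/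
theorem exists_injective_step (Y T : Finset V)
    (h : ∀ Z : Finset V, Z.card < Y.card →
      ∃ y ∈ Y, ∃ t ∈ T, y ∉ Z ∧ ReachIn A (↑Z)ᶜ y t) :
    ∃ f : {v // v ∉ T} → V, Function.Injective f ∧
      ∀ v, f v ∉ Y ∧ (f v = v ∨ A v (f v)) := by
  classical
  let N : {v // v ∉ T} → Finset V := fun v => {x | x ∉ Y ∧ (x = v ∨ A v x)}
  suffices hall : ∀ s : Finset {v // v ∉ T}, s.card ≤ (s.biUnion N).card by
    obtain ⟨f, hf, hfN⟩ := (Finset.all_card_le_biUnion_card_iff_exists_injective N).1 hall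
    exact ⟨f, hf, fun v => by simpa [N] using hfN v⟩
  intro s
  by_contra! hs
  set W : Finset V := s.map (Function.Embedding.subtype _) with hW
  set U : Finset V := s.biUnion N with hU
  have hWcard : W.card = s.card := Finset.card_map _
  have hWT : ∀ x ∈ W, x ∉ T := by
    intro x hx
    obtain ⟨v, _, rfl⟩ := Finset.mem_map.1 hx
    exact v.2
  have hUmem : ∀ x ∈ W, ∀ z, z ∉ Y → (z = x ∨ A x z) → z ∈ U := by
    intro x hx z hz hxz
    obtain ⟨v, hv, rfl⟩ := Finset.mem_map.1 hx
    exact Finset.mem_biUnion.2 ⟨v, hv, by simpa [N] using ⟨hz, hxz⟩⟩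
  have hsub : W \ Y ⊆ U ∩ W := fun x hx => by
    rw [Finset.mem_sdiff] at hx
    exact Finset.mem_inter.2 ⟨hUmem x hx.1 x hx.2 (Or.inl rfl), hx.1⟩
  have hcard : (Y \ W ∪ U \ W).card < Y.card := by
    have h1 := Finset.card_union_le (Y \ W) (U \ W)
    have h2 := Finset.card_sdiff_add_card_inter U W
    have h3 := Finset.card_sdiff_add_card_inter W Y
    have h4 := Finset.card_sdiff_add_card_inter Y W
    have h5 := Finset.card_le_card hsub
    rw [Finset.inter_comm Y W] at h4
    omega
  obtain ⟨y, hy, t, ht, hyZ, hreach⟩ := h _ hcard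
  have hyW : y ∈ W := by
    by_contra hyW
    exact hyZ (Finset.mem_union_left _ (Finset.mem_sdiff.2 ⟨hy, hyW⟩))
  have stay : t ∈ W := by
    clear ht
    induction hreach with
    | refl => exact hyW
    | @tail b c _ hbc ih =>
      by_contra hc
      have hcZ : c ∉ Y \ W ∪ U \ W := by simpa using hbc.2.2
      simp only [Finset.mem_union, Finset.mem_sdiff, hc, not_false_iff, and_true, not_or] at hcZ
      exact hcZ.2 (hUmem b ih c hcZ.1 (Or.inr hbc.1))
  exact hWT t stay ht

/-- Menger's theorem for equicardinal vertex sets, listed by `a` and `b`. -/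
theorem exists_linkage {ι : Type*} [Fintype ι] {a b : ι → V} (ha : Function.Injective a)
    (h : ∀ Z : Finset V, Z.card < Fintype.card ι →
      ∃ i j, a i ∉ Z ∧ ReachIn A (↑Z)ᶜ (a i) (b j)) :
    ∃ (q : ι → DPath A) (σ : Equiv.Perm ι), (∀ i, (q i).first = a i) ∧
      (∀ i, (q i).last = b (σ i)) ∧ Pairwise fun i j => Disjoint (q i).verts (q j).verts := by
  classical
  set Y : Finset V := Finset.univ.image a with hYdef
  set T : Finset V := Finset.univ.image b with hTdef
  have hYcard : Y.card = Fintype.card ι := Finset.card_image_of_injective _ ha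
  have haY : ∀ i, a i ∈ Y := fun i => Finset.mem_image_of_mem a (Finset.mem_univ i)
  obtain ⟨φ, hφ, hstep⟩ := exists_injective_step (A := A) Y T (by
    intro Z hZ
    obtain ⟨i, j, h1, h2⟩ := h Z (hYcard ▸ hZ)
    exact ⟨a i, haY i, b j, Finset.mem_image_of_mem b (Finset.mem_univ j), h1, h2⟩)
  let f : V → V := fun v => if hv : v ∉ T then φ ⟨v, hv⟩ else v
  have hf : ∀ v (hv : v ∉ T), f v = φ ⟨v, hv⟩ := fun v hv => dif_pos hv
  have hinj : ∀ u ∉ T, ∀ v ∉ T, f u = f v → u = v := by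
    intro u hu v hv huv
    rw [hf u hu, hf v hv] at huv
    exact congrArg Subtype.val (hφ huv)
  have hfY : ∀ v ∉ T, f v ∉ Y := fun v hv => by
    rw [hf v hv]
    exact (hstep _).1
  have hex : ∀ i, ∃ s, f^[s] (a i) ∈ T := by
    intro i
    by_contra! hno
    obtain ⟨s, t, hst, heq⟩ := Finite.exists_ne_map_eq_of_infinite fun s : ℕ => f^[s] (a i)
    exact hst (iterate_eq_iterate hinj hfY (haY i) (haY i) (fun s _ => hno s)
      (fun s _ => hno s) heq).1
  have hmin : ∀ i, ∀ s < Nat.find (hex i), f^[s] (a i) ∉ T := fun i s hs => Nat.find_min _ hs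
  have huniq : ∀ i j s t, s ≤ Nat.find (hex i) → t ≤ Nat.find (hex j) →
      f^[s] (a i) = f^[t] (a j) → s = t ∧ i = j := by
    intro i j s t hs ht heq
    have := iterate_eq_iterate hinj hfY (haY i) (haY j)
      (fun r hr => hmin i r (by omega)) (fun r hr => hmin j r (by omega)) heq
    exact ⟨this.1, ha this.2⟩
  let q : ι → DPath A := fun i =>
    { len := Nat.find (hex i)
      pt := fun s => f^[s] (a i)
      adj := by
        intro s hs
        have hne : f^[s + 1] (a i) ≠ f^[s] (a i) := fun heq => by
          have := (huniq i i (s + 1) s hs hs.le heq).1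
          omega
        rw [Function.iterate_succ_apply'] at hne ⊢
        rw [hf _ (hmin i s hs)] at hne ⊢
        exact (hstep _).2.resolve_left hne
      inj := fun s hs t ht heq => (huniq i i s t hs ht heq).1 }
  have hlast : ∀ i, ∃ j, b j = (q i).last := fun i => by
    obtain ⟨j, -, hj⟩ := Finset.mem_image.1 (Nat.find_spec (hex i))
    exact ⟨j, hj⟩
  choose σ hσ using hlast
  have hdisj : ∀ i j, i ≠ j → Disjoint (q i).verts (q j).verts := by
    intro i j hij
    rw [Set.disjoint_left]
    rintro x ⟨s, hs, rfl⟩ ⟨t, ht, heq⟩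
    exact hij (huniq i j s t hs ht heq.symm).2
  have hσinj : Function.Injective σ := by
    intro i j hij
    by_contra hne
    refine Set.disjoint_left.1 (hdisj i j hne) (q i).last_mem ?_
    rw [← hσ, hij, hσ]
    exact (q j).last_mem
  exact ⟨q, Equiv.ofBijective σ (Finite.injective_iff_bijective.1 hσinj), fun i => rfl,
    fun i => (hσ i).symm, fun i j hij => hdisj i j hij⟩

end Menger

/-- Only few members of a disjoint family meet a given finite set. -/
theorem exists_finset_hit {V ι : Type*} [Fintype ι] {D : ι → Set V}
    (hD : Pairwise fun i j => Disjoint (D i) (D j)) (Z : Finset V) :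
    ∃ H : Finset ι, H.card ≤ Z.card ∧ ∀ i ∉ H, Disjoint (D i) ↑Z := by
  classical
  refine ⟨Finset.univ.filter fun i => ∃ z ∈ Z, z ∈ D i, ?_, fun i hi => ?_⟩
  · refine Finset.card_le_card_of_forall_subsingleton (fun i z => z ∈ D i) (by simp) ?_
    rintro z - i hi j hj
    by_contra hij
    exact Set.disjoint_left.1 (hD hij) hi.2 hj.2
  · rw [Set.disjoint_left]
    simp only [Finset.mem_filter, Finset.mem_univ, true_and, not_exists, not_and] at hi
    exact fun z hz hzZ => hi z hzZ hz

/-- Among many large sets one can choose pairwise unrelated representatives, unless two of the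
sets have large completely related subsets. -/
theorem exists_biclique_or_transversal (d M : ℕ) : ∃ b : ℕ, ∀ {η β : Type} [Nonempty β] (E : Finset η)
    (T : η → Finset β) (r : β → β → Prop), (∀ x y, r x y → r y x) → E.card = M →
    (∀ e ∈ E, b ≤ (T e).card) →
    (∃ e ∈ E, ∃ f ∈ E, e ≠ f ∧ ∃ U ⊆ T e, ∃ U' ⊆ T f, U.card = d ∧ U'.card = d ∧
      ∀ x ∈ U, ∀ y ∈ U', r x y) ∨
    ∃ x : η → β, (∀ e ∈ E, x e ∈ T e) ∧ ∀ e ∈ E, ∀ f ∈ E, e ≠ f → ¬ r (x e) (x f) := by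
  classical
  induction M with
  | zero =>
    refine ⟨1, fun {η β} _ E T r _ hE _ => ?_⟩
    obtain rfl := Finset.card_eq_zero.1 hE
    exact Or.inr ⟨fun _ => Classical.arbitrary β, by simp, by simp⟩
  | succ M ih =>
    obtain ⟨b, hb⟩ := ih
    refine ⟨d * b + d + M * d + 1, fun {η β} _ E T r hr hE hT => ?_⟩
    obtain ⟨e₀, E', he₀, rfl, hE'⟩ := Finset.card_eq_succ.1 hE
    by_cases hgood : ∃ x ∈ T e₀, ∀ f ∈ E', b ≤ ((T f).filter fun y => ¬ r x y).card
    · obtain ⟨x, hx, hxf⟩ := hgood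
      rcases hb E' (fun f => (T f).filter fun y => ¬ r x y) r hr hE' hxf with
        ⟨e, he, f, hf, hef, U, hU, U', hU', h⟩ | ⟨s, hs, hind⟩
      · exact Or.inl ⟨e, Finset.mem_insert_of_mem he, f, Finset.mem_insert_of_mem hf, hef,
          U, hU.trans (Finset.filter_subset _ _), U', hU'.trans (Finset.filter_subset _ _), h⟩
      · have hne : ∀ e ∈ E', e ≠ e₀ := fun e he h => he₀ (h ▸ he)
        have hs' : ∀ e ∈ E', s e ∈ T e ∧ ¬ r x (s e) := fun e he => by simpa using hs e he
        refine Or.inr ⟨Function.update s e₀ x, fun e he => ?_, fun e he f hf hef => ?_⟩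
        · rcases Finset.mem_insert.1 he with rfl | he
          · simpa using hx
          · simpa [hne e he] using (hs' e he).1
        · rcases Finset.mem_insert.1 he with rfl | he' <;>
            rcases Finset.mem_insert.1 hf with rfl | hf'
          · exact absurd rfl hef
          · simpa [hne f hf'] using (hs' f hf').2
          · simpa [hne e he'] using fun h => (hs' e he').2 (hr _ _ h)
          · simpa [hne e he', hne f hf'] using hind e he' f hf' hef
    · left
      push Not at hgood
      have : Nonempty η := ⟨e₀⟩
      choose! g hg hgb using hgood
      have hcard : E'.card * d < (T e₀).card := by
        have := hT e₀ (Finset.mem_insert_self _ _)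
        rw [hE']
        omega
      obtain ⟨f, hf, hfib⟩ := Finset.exists_lt_card_fiber_of_mul_lt_card_of_maps_to hg hcard
      obtain ⟨U, hU, hUcard⟩ := Finset.exists_subset_card_eq hfib.le
      have hU' : ∀ x ∈ U, x ∈ T e₀ ∧ g x = f := fun x hx => by simpa using hU hx
      set bad : Finset β := U.biUnion fun x => (T f).filter fun y => ¬ r x y with hbad
      have hbadcard : bad.card ≤ d * b := by
        rw [← hUcard]
        refine Finset.card_biUnion_le_card_mul _ _ _ fun x hx => ?_
        have := hgb x (hU' x hx).1
        rw [(hU' x hx).2] at this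
        exact this.le
      have hrest : d ≤ (T f \ bad).card := by
        have h1 := Finset.le_card_sdiff bad (T f)
        have h2 := hT f (Finset.mem_insert_of_mem hf)
        omega
      obtain ⟨U₂, hU₂, hU₂card⟩ := Finset.exists_subset_card_eq hrest
      refine ⟨e₀, Finset.mem_insert_self _ _, f, Finset.mem_insert_of_mem hf,
        fun h => he₀ (h ▸ hf), U, fun x hx => (hU' x hx).1, U₂,
        hU₂.trans Finset.sdiff_subset, hUcard, hU₂card, fun x hx y hy => ?_⟩
      have := Finset.mem_sdiff.1 (hU₂ hy)
      by_contra hxy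
      exact this.2 (Finset.mem_biUnion.2 ⟨x, hx, Finset.mem_filter.2 ⟨this.1, hxy⟩⟩)

section Haven

variable {V : Type*} {A : V → V → Prop} {B : Finset V → Set V} {w : ℕ}

/-- The set `U` meets all the sets `B Z` with fewer than `k` vertices in `Z`. -/
def Big (B : Finset V → Set V) (k : ℕ) (U : Set V) : Prop :=
  ∀ Z : Finset V, Z.card < k → ∃ u ∈ U, u ∈ B Z

theorem IsHavenOn.big_or (hB : IsHavenOn A Set.univ w B) {k₁ k₂ : ℕ} {U₁ U₂ : Set V}
    (h : Big B (k₁ + k₂) (U₁ ∪ U₂)) (hw : k₁ + k₂ ≤ w) : Big B k₁ U₁ ∨ Big B k₂ U₂ := by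
  classical
  by_contra! hno
  simp only [Big, not_forall, not_exists, not_and] at hno
  obtain ⟨⟨Z₁, hZ₁, h₁⟩, ⟨Z₂, hZ₂, h₂⟩⟩ := hno
  have hcard : (Z₁ ∪ Z₂).card < k₁ + k₂ := (Finset.card_union_le _ _).trans_lt (by omega)
  obtain ⟨u, hu, huB⟩ := h _ hcard
  have hmono := (hB _ (Set.subset_univ _) (hcard.trans_le hw)).2
  rcases hu with hu | hu
  · exact h₁ u hu (hmono Z₁ Finset.subset_union_left huB)
  · exact h₂ u hu (hmono Z₂ Finset.subset_union_right huB)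

theorem DPath.exists_of_list {l : List V} (hne : l ≠ []) (hnd : l.Nodup) (hch : l.IsChain A) :
    ∃ q : DPath A, ∀ v, v ∈ q.verts ↔ v ∈ l := by
  have hpos : 0 < l.length := List.length_pos_of_ne_nil hne
  refine ⟨⟨l.length - 1, fun i => l.getD i (l.head hne), fun i hi => ?_, fun i hi j hj h => ?_⟩,
    fun v => ?_⟩
  · rw [List.getD_eq_getElem _ _ (by omega), List.getD_eq_getElem _ _ (by omega)]
    exact List.isChain_iff_getElem.1 hch i (by omega)
  · rw [List.getD_eq_getElem _ _ (by omega), List.getD_eq_getElem _ _ (by omega)] at h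
    exact (hnd.getElem_inj_iff).1 h
  · rw [List.mem_iff_getElem]
    constructor
    · rintro ⟨i, hi, rfl⟩
      exact ⟨i, by simp only at hi; omega, (List.getD_eq_getElem _ _ _).symm⟩
    · rintro ⟨i, hi, rfl⟩
      exact ⟨i, by simp only; omega, List.getD_eq_getElem _ _ _⟩

/-- Some directed path meets all the components `B Z` with `Z` small. -/
theorem IsHavenOn.exists_big_path [Fintype V] (hB : IsHavenOn A Set.univ w B) {K : ℕ} (hK : 0 < K)
    (hKw : 2 * K ≤ w) : ∃ q : DPath A, Big B K q.verts := by
  classical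
  by_contra! hno
  have hext : ∀ n : ℕ, ∃ (l : List V) (v : V) (Z : Finset V), n ≤ l.length ∧
      (l ++ [v]).IsChain A ∧ (l ++ [v]).Nodup ∧ Z.card < K ∧ v ∈ B Z ∧ ∀ x ∈ l, x ∉ B Z := by
    intro n
    induction n with
    | zero =>
      obtain ⟨v, hv⟩ := (hB ∅ (Set.subset_univ _) (by simp; omega)).1.2.1
      exact ⟨[], v, ∅, le_rfl, by simp, by simp, by simpa using hK, hv, by simp⟩
    | succ n ih =>
      obtain ⟨l, v, Z, hn, hch, hnd, hZ, hv, hl⟩ := ih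
      obtain ⟨q, hq⟩ := DPath.exists_of_list (by simp) hnd hch
      have hnb := hno q
      simp only [Big, not_forall, not_exists, not_and] at hnb
      obtain ⟨Z', hZ', hmiss⟩ := hnb
      have hmiss' : ∀ x ∈ l ++ [v], x ∉ B Z' := fun x hx => hmiss x ((hq x).2 hx)
      have hcard : (Z ∪ Z').card < w := (Finset.card_union_le _ _).trans_lt (by omega)
      obtain ⟨⟨-, ⟨u, hu⟩, -⟩, hmono⟩ := hB (Z ∪ Z') (Set.subset_univ _) hcard
      have huZ := hmono Z Finset.subset_union_left hu
      have huZ' := hmono Z' Finset.subset_union_right hu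
      obtain ⟨s, ⟨⟨-, hsnd, hsch⟩, hsB⟩, hsh, hsl⟩ :=
        (hB Z (Set.subset_univ _) (by omega)).1.2.2.1 v hv u huZ
      have hfind : (s.find? fun x => decide (x ∈ B Z')).isSome := by
        rw [List.find?_isSome]
        exact ⟨u, List.mem_of_getLast? hsl, by simpa using huZ'⟩
      obtain ⟨y, hy⟩ := Option.isSome_iff_exists.1 hfind
      obtain ⟨hyB, s₁, s₂, rfl, hs₁⟩ := List.find?_eq_some_iff_append.1 hy
      simp only [decide_eq_true_eq] at hyB
      have hs₁' : ∀ x ∈ s₁, x ∉ B Z' := fun x hx => by simpa using hs₁ x hx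
      rcases s₁ with _ | ⟨v', s₁⟩
      · obtain rfl : y = v := by simpa using hsh
        exact absurd hyB (hmiss' y (by simp))
      obtain rfl : v' = v := by simpa using hsh
      have hsplit : (v' :: s₁) ++ y :: s₂ = ((v' :: s₁) ++ [y]) ++ s₂ := by simp
      rw [hsplit] at hsnd hsch hsB
      refine ⟨l ++ (v' :: s₁), y, Z', by simp; omega, ?_, ?_, hZ', hyB, ?_⟩
      · have : l ++ (v' :: s₁) ++ [y] = l ++ v' :: (s₁ ++ [y]) := by simp
        rw [this, List.isChain_split]
        exact ⟨hch, (List.isChain_append.1 hsch).1⟩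
      · rw [List.append_assoc, List.nodup_append]
        refine ⟨(List.nodup_append.1 hnd).1, (List.nodup_append.1 hsnd).1, ?_⟩
        rintro a ha b hb rfl
        exact hl a ha (hsB a (List.mem_append_left _ hb))
      · intro x hx
        rcases List.mem_append.1 hx with hx | hx
        · exact hmiss' x (List.mem_append_left _ hx)
        · exact hs₁' x hx
  obtain ⟨l, v, Z, hn, -, hnd, -⟩ := hext (Fintype.card V)
  have := hnd.length_le_card
  simp at this
  omega

/-- The vertices of `q` at positions in `[a, e)`. -/
def DPath.seg (q : DPath A) (a e : ℕ) : Set V := {v | ∃ j, a ≤ j ∧ j < e ∧ q.pt j = v}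

theorem IsHavenOn.exists_segments (hB : IsHavenOn A Set.univ w B) (q : DPath A) {k : ℕ}
    (hk : 0 < k) (t a : ℕ) (h : Big B (t * (k + 1)) (q.seg a (q.len + 1)))
    (hw : t * (k + 1) ≤ w) :
    ∃ c : ℕ → ℕ, c 0 = a ∧ ∀ i < t, c i < c (i + 1) ∧ c (i + 1) ≤ q.len + 1 ∧
      Big B k (q.seg (c i) (c (i + 1))) := by
  classical
  induction t generalizing a with
  | zero => exact ⟨fun _ => a, rfl, by simp⟩
  | succ t ih =>
    have hle : k ≤ (t + 1) * (k + 1) := by nlinarith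
    have hex : ∃ e, Big B k (q.seg a e) :=
      ⟨q.len + 1, fun Z hZ => h Z (hZ.trans_le hle)⟩
    set e := Nat.find hex with he
    have hbig : Big B k (q.seg a e) := Nat.find_spec hex
    have heL : e ≤ q.len + 1 := Nat.find_min' hex fun Z hZ => h Z (hZ.trans_le hle)
    have hae : a < e := by
      obtain ⟨u, ⟨j, h1, h2, -⟩, -⟩ := hbig ∅ (by simpa using hk)
      omega
    have hnot : ¬ Big B (k + 1) (q.seg a e) := by
      have hmin := Nat.find_min hex (show e - 1 < Nat.find hex by omega)
      simp only [Big, not_forall, not_exists, not_and] at hmin ⊢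
      obtain ⟨Z, hZ, hmiss⟩ := hmin
      have hZk : (insert (q.pt (e - 1)) Z).card < k + 1 :=
        (Finset.card_insert_le _ _).trans_lt (by omega)
      obtain ⟨hsc, hmono⟩ := hB (insert (q.pt (e - 1)) Z) (Set.subset_univ _)
        (lt_of_lt_of_le hZk (by nlinarith))
      refine ⟨insert (q.pt (e - 1)) Z, hZk, ?_⟩
      rintro u ⟨j, h1, h2, rfl⟩ hu
      rcases Nat.lt_or_ge j (e - 1) with hj | hj
      · exact hmiss _ ⟨j, h1, hj, rfl⟩ (hmono Z (Finset.subset_insert _ _) hu)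
      · obtain rfl : j = e - 1 := by omega
        exact (hsc.1 hu).2 (by simp)
    have hunion : q.seg a (q.len + 1) ⊆ q.seg a e ∪ q.seg e (q.len + 1) := by
      rintro u ⟨j, h1, h2, rfl⟩
      rcases Nat.lt_or_ge j e with hj | hj
      · exact Or.inl ⟨j, h1, hj, rfl⟩
      · exact Or.inr ⟨j, hj, h2, rfl⟩
    have hsum : (k + 1) + t * (k + 1) = (t + 1) * (k + 1) := by ring
    have hrest : Big B (t * (k + 1)) (q.seg e (q.len + 1)) := by
      refine (hB.big_or (k₁ := k + 1) (fun Z hZ => ?_) (by omega)).resolve_left hnot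
      obtain ⟨u, hu, huB⟩ := h Z (by omega)
      exact ⟨u, hunion hu, huB⟩
    obtain ⟨c, hc0, hc⟩ := ih e hrest (by omega)
    refine ⟨fun i => Nat.casesOn i a c, rfl, fun i hi => ?_⟩
    rcases i with _ | i
    · simpa [hc0] using ⟨hae, heL, hbig⟩
    · simpa using hc i (by omega)

/-- A digraph with a haven of large order has a path with many vertices, at positions
`pos 0 < pos 1 < ⋯`, between any two equicardinal sets of which there is a linkage. -/
theorem IsHavenOn.exists_linked_path [Fintype V] (hB : IsHavenOn A Set.univ w B) {M : ℕ}
    (hM : 0 < M) (hw : 2 * (2 * M * (M + 1)) ≤ w) :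
    ∃ (q : DPath A) (pos : ℕ → ℕ), (∀ i j, i < j → j < M → pos i < pos j) ∧
      (∀ i < M, pos i ≤ q.len) ∧ ∀ {ι : Type} [Fintype ι] (a b : ι → ℕ),
        Function.Injective a → Function.Injective b → (∀ i, a i < M) → (∀ i, b i < M) →
        ∃ (p : ι → DPath A) (σ : Equiv.Perm ι), (∀ i, (p i).first = q.pt (pos (a i))) ∧
          (∀ i, (p i).last = q.pt (pos (b (σ i)))) ∧
          Pairwise fun i j => Disjoint (p i).verts (p j).verts := by
  obtain ⟨q, hq⟩ := hB.exists_big_path (K := 2 * M * (M + 1)) (by positivity) hw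
  have hq' : Big B (2 * M * (M + 1)) (q.seg 0 (q.len + 1)) := fun Z hZ => by
    obtain ⟨u, ⟨j, hj, rfl⟩, hu⟩ := hq Z hZ
    exact ⟨_, ⟨j, Nat.zero_le _, by omega, rfl⟩, hu⟩
  obtain ⟨c, -, hc⟩ := hB.exists_segments q hM (2 * M) 0 hq' (by omega)
  have hmono : ∀ i j, i ≤ j → j ≤ 2 * M → c i ≤ c j := by
    intro i j hij
    induction j, hij using Nat.le_induction with
    | base => exact fun _ => le_rfl
    | succ j hij ih => exact fun hj => (ih (by omega)).trans (hc j (by omega)).1.le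
  have hinjOn : ∀ i < M, ∀ j < M, q.pt (c (2 * i + 1)) = q.pt (c (2 * j + 1)) → i = j := by
    intro i hi j hj h
    have h1 := hc (2 * i + 1) (by omega)
    have h2 := hc (2 * j + 1) (by omega)
    have h3 := q.inj _ (by omega) _ (by omega) h
    by_contra hne
    rcases Nat.lt_or_gt_of_ne hne with hlt | hlt
    · have := hmono (2 * i + 1 + 1) (2 * j + 1) (by omega) (by omega)
      omega
    · have := hmono (2 * j + 1 + 1) (2 * i + 1) (by omega) (by omega)
      omega
  refine ⟨q, fun i => c (2 * i + 1), fun i j hij hj => ?_, fun i hi => ?_, ?_⟩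
  · have h1 := hc (2 * i + 1) (by omega)
    exact h1.1.trans_le (hmono (2 * i + 1 + 1) (2 * j + 1) (by omega) (by omega))
  · have h1 := hc (2 * i + 1) (by omega)
    exact Nat.le_of_lt_succ (h1.1.trans_le h1.2.1)
  intro ι _ a b ha hb haM hbM
  refine exists_linkage (a := fun i => q.pt (c (2 * a i + 1)))
    (b := fun i => q.pt (c (2 * b i + 1))) (fun i j h => ha (hinjOn _ (haM i) _ (haM j) h))
    fun Z hZ => ?_
  have hcardM : Fintype.card ι ≤ M := by
    have := Fintype.card_le_of_injective (fun i => (⟨a i, haM i⟩ : Fin M))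
      fun i j h => ha (by simpa using h)
    simpa using this
  have hsep : ∀ f : ι → ℕ, Function.Injective f → (∀ i, f i < M) →
      ∃ i, Disjoint (q.seg (c (2 * f i)) (c (2 * f i + 1 + 1))) (Z : Set V) := by
    intro f hf hfM
    have hlt : ∀ i j, f i < f j →
        Disjoint (q.seg (c (2 * f i)) (c (2 * f i + 1 + 1)))
          (q.seg (c (2 * f j)) (c (2 * f j + 1 + 1))) := by
      intro i j hij
      rw [Set.disjoint_left]
      rintro v ⟨s, hs1, hs2, rfl⟩ ⟨t, ht1, ht2, hst⟩
      have h1 := hmono (2 * f i + 1 + 1) (2 * f j) (by omega) (by have := hfM j; omega)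
      have h2 := hc (2 * f j + 1) (by have := hfM j; omega)
      have := q.inj _ (by omega) _ (by omega) hst
      omega
    obtain ⟨H, hH, hHd⟩ := exists_finset_hit
      (D := fun i => q.seg (c (2 * f i)) (c (2 * f i + 1 + 1))) (fun i j hij => by
        rcases Nat.lt_or_gt_of_ne (fun h => hij (hf h)) with h | h
        · exact hlt i j h
        · exact (hlt j i h).symm) Z
    obtain ⟨i, hi⟩ : ∃ i, i ∉ H := by
      by_contra! hall
      have : H = Finset.univ := Finset.eq_univ_iff_forall.2 hall
      rw [this, Finset.card_univ] at hH
      omega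
    exact ⟨i, hHd i hi⟩
  have along : ∀ s t, s ≤ t → t ≤ q.len → (∀ r, s ≤ r → r ≤ t → q.pt r ∉ Z) →
      ReachIn A (↑Z)ᶜ (q.pt s) (q.pt t) := by
    intro s t hst ht hr
    have h1 := DPath.EdgesIn.reach_last (q.slice s t hst ht).adj (q.slice s t hst ht).first_mem
    rw [DPath.slice_first, DPath.slice_last] at h1
    refine h1.mono fun v hv => ?_
    obtain ⟨r, h1, h2, rfl⟩ := (DPath.mem_slice hst ht).1 hv
    exact hr r h1 h2
  obtain ⟨i, hi⟩ := hsep a ha haM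
  obtain ⟨j, hj⟩ := hsep b hb hbM
  have hcom := (hB Z (Set.subset_univ _) (by nlinarith)).1
  have hai := haM i
  have hbj := hbM j
  have e1 := hc (2 * a i) (by omega)
  have e2 := hc (2 * a i + 1) (by omega)
  have e3 := hc (2 * b j) (by omega)
  have e4 := hc (2 * b j + 1) (by omega)
  obtain ⟨x, ⟨s, hs1, hs2, rfl⟩, hx⟩ := e2.2.2 Z (by omega)
  obtain ⟨y, ⟨t, ht1, ht2, rfl⟩, hy⟩ := e3.2.2 Z (by omega)
  have hBZ : B Z ⊆ (↑Z : Set V)ᶜ := fun v hv => (hcom.1 hv).2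
  have r1 := along (c (2 * a i + 1)) s hs1 (by omega) fun r h1 h2 =>
    Set.disjoint_left.1 hi ⟨r, by omega, by omega, rfl⟩
  have r2 := (ReachIn.of_strongOn hcom.2.2.1 hx hy).mono hBZ
  have r3 := along t (c (2 * b j + 1)) ht2.le (by omega) fun r h1 h2 =>
    Set.disjoint_left.1 hj ⟨r, by omega, by omega, rfl⟩
  exact ⟨i, j, Set.disjoint_left.1 hi ⟨_, by omega, by omega, rfl⟩, (r1.trans r2).trans r3⟩

end Haven

namespace LinkRing

variable {V ι κ : Type*} {A : V → V → Prop}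

/-- The vertices of the paths of the ring with index in `P`. -/
def part (R : LinkRing A ι) (P : Set ι) : Set V :=
  {x | ∃ u ∈ P, x ∈ (R.l u).verts ∨ x ∈ (R.r u).verts}

theorem l_subset_part {R : LinkRing A ι} {P : Set ι} {u : ι} (hu : u ∈ P) :
    (R.l u).verts ⊆ R.part P := fun _ hx => ⟨u, hu, Or.inl hx⟩

theorem r_subset_part {R : LinkRing A ι} {P : Set ι} {u : ι} (hu : u ∈ P) :
    (R.r u).verts ⊆ R.part P := fun _ hx => ⟨u, hu, Or.inr hx⟩

theorem exists_hit [Fintype ι] (R : LinkRing A ι) (Z : Finset V) :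
    ∃ H : Finset ι, H.card ≤ 2 * Z.card ∧
      ∀ P : Set ι, (∀ u ∈ P, u ∉ H) → Disjoint (R.part P) ↑Z := by
  classical
  obtain ⟨H₁, h₁, hd₁⟩ := exists_finset_hit R.l_disj Z
  obtain ⟨H₂, h₂, hd₂⟩ := exists_finset_hit R.r_disj Z
  refine ⟨H₁ ∪ H₂, (Finset.card_union_le _ _).trans (by omega), fun P hP => ?_⟩
  rw [Set.disjoint_left]
  rintro x ⟨u, hu, hx⟩
  have := hP u hu
  rw [Finset.mem_union, not_or] at this
  rcases hx with hx | hx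
  · exact Set.disjoint_left.1 (hd₁ u this.1) hx
  · exact Set.disjoint_left.1 (hd₂ u this.2) hx

theorem EdgesIn.reach_iterate {R : LinkRing A ι} {E : V → V → Prop} (h : R.EdgesIn E) {P : Set ι}
    (hP : ∀ u ∈ P, R.next u ∈ P) {v : ι} (hv : v ∈ P) (k : ℕ) :
    R.next^[k] v ∈ P ∧ ReachIn E (R.part P) (R.mark v) (R.mark (R.next^[k] v)) := by
  induction k with
  | zero => exact ⟨hv, ReachIn.refl _⟩
  | succ k ih =>
    rw [Function.iterate_succ_apply']
    exact ⟨hP _ ih.1, ih.2.trans ((h.reach_mark_next _).mono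
      (Set.union_subset (r_subset_part ih.1) (l_subset_part (hP _ ih.1))))⟩

theorem EdgesIn.reach_cross_part {R : LinkRing A ι} {C : LinkRing A κ} {E : V → V → Prop}
    (hR : R.EdgesIn E) (hC : C.EdgesIn E) {P : Set ι} {Q : Set κ} {i : ι} {j : κ}
    (hi : i ∈ P) (hi' : R.next i ∈ P) (hj : j ∈ Q)
    (hx : ((R.l (R.next i)).verts ∩ (C.l j).verts).Nonempty) :
    ReachIn E (R.part P ∪ C.part Q) (R.mark i) (C.mark j) :=
  (hR.reach_cross hC hx).mono (Set.union_subset_union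
    (Set.union_subset (r_subset_part hi) (l_subset_part hi')) (l_subset_part hj))

theorem exists_disjoint_part_pair {d n : ℕ} (hd : 4 * n ≤ d) (R : LinkRing A (Fin d))
    (Z : Finset V) (hZ : Z.card < n) : ∃ i, Disjoint (R.part {i, R.next i}) ↑Z := by
  classical
  obtain ⟨H, hH, hHd⟩ := R.exists_hit Z
  obtain ⟨i, hi⟩ : ∃ i, i ∉ H ∪ H.image R.next.symm := by
    by_contra! hall
    have h1 : H ∪ H.image R.next.symm = Finset.univ := Finset.eq_univ_iff_forall.2 hall
    have h2 := Finset.card_union_le H (H.image R.next.symm)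
    have h3 := Finset.card_image_le (s := H) (f := R.next.symm)
    rw [h1, Finset.card_univ, Fintype.card_fin] at h2
    omega
  rw [Finset.mem_union, not_or] at hi
  refine ⟨i, hHd _ ?_⟩
  rintro u (rfl | rfl) hu
  · exact hi.1 hu
  · exact hi.2 (Finset.mem_image.2 ⟨_, hu, by simp⟩)

/-- Two rings all of whose main paths cross give a subdigraph as required. -/
theorem exists_of_crossing [Fintype V] [DecidableEq V] {d n : ℕ} (hn : 0 < n) (hd : 4 * n ≤ d)
    (R C : LinkRing A (Fin d)) (hx : ∀ i j, ((R.l i).verts ∩ (C.l j).verts).Nonempty) :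
    ∃ (S : Set V) (A' : V → V → Prop),
      IsSubdigraph A S A' ∧ Eulerianizable A' S 6 ∧ ∃ w, n ≤ w ∧ HasHavenOn A' S w := by
  refine exists_eulerianizable hn R C id id (fun i => R.part {i, R.next i})
    (fun j => C.part {j, C.next j}) (R.exists_disjoint_part_pair hd)
    (C.exists_disjoint_part_pair hd) (fun i => l_subset_part (by simp) (R.l i).last_mem)
    (fun E hR hC i j => ⟨?_, ?_⟩) (fun E _ v => ⟨v, ReachIn.refl _, ReachIn.refl _⟩)
    (fun E _ v => ⟨v, ReachIn.refl _, ReachIn.refl _⟩)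
  · exact hR.reach_cross_part hC (by simp) (by simp) (by simp) (hx _ _)
  · rw [Set.union_comm]
    exact hC.reach_cross_part hR (by simp) (by simp) (by simp) (Set.inter_comm _ _ ▸ hx _ _)

theorem exists_disjoint_part_fiber {m n : ℕ} [NeZero m] [Fintype ι] (hm : 4 * n ≤ m)
    (R : LinkRing A ι) (f : ι → ZMod m) (Z : Finset V) (hZ : Z.card < n) :
    ∃ i, Disjoint (R.part {v | f v = i}) ↑Z := by
  classical
  obtain ⟨H, hH, hHd⟩ := R.exists_hit Z
  obtain ⟨i, hi⟩ : ∃ i, i ∉ H.image f := by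
    by_contra! hall
    have h1 : H.image f = Finset.univ := Finset.eq_univ_iff_forall.2 hall
    have h2 := Finset.card_image_le (s := H) (f := f)
    rw [h1, Finset.card_univ, ZMod.card] at h2
    omega
  refine ⟨i, hHd _ ?_⟩
  rintro u rfl hu
  exact hi (Finset.mem_image_of_mem _ hu)

/-- Two rings that run through the rows and the columns of a toroidal array and cross at each
of its places give a subdigraph as required. -/
theorem exists_of_grid [Fintype V] [DecidableEq V] {m n : ℕ} [NeZero m] (hn : 0 < n)
    (hm : 4 * n ≤ m) (R C : LinkRing A (ZMod m × ZMod m))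
    (hRn : ∀ v, R.next v = (v.1, v.2 + 1)) (hCn : ∀ v, C.next v = (v.1 + 1, v.2))
    (hx : ∀ v, ((R.l v).verts ∩ (C.l v).verts).Nonempty) :
    ∃ (S : Set V) (A' : V → V → Prop),
      IsSubdigraph A S A' ∧ Eulerianizable A' S 6 ∧ ∃ w, n ≤ w ∧ HasHavenOn A' S w := by
  have hRit : ∀ (k : ℕ) (i j : ZMod m), R.next^[k] (i, j) = (i, j + k) := by
    intro k
    induction k with
    | zero => simp
    | succ k ih => intro i j; rw [Function.iterate_succ_apply', ih, hRn]; simp [add_assoc]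
  have hCit : ∀ (k : ℕ) (i j : ZMod m), C.next^[k] (i, j) = (i + k, j) := by
    intro k
    induction k with
    | zero => simp
    | succ k ih => intro i j; rw [Function.iterate_succ_apply', ih, hCn]; simp [add_assoc]
  have hrow : ∀ E, R.EdgesIn E → ∀ i j j',
      ReachIn E (R.part {v | v.1 = i}) (R.mark (i, j)) (R.mark (i, j')) := by
    intro E hE i j j'
    have := (hE.reach_iterate (P := {v | v.1 = i}) (fun u hu => by simpa [hRn] using hu)
      (v := (i, j)) rfl (j' - j).val).2
    rwa [hRit, ZMod.natCast_zmod_val, add_sub_cancel] at this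
  have hcol : ∀ E, C.EdgesIn E → ∀ j i i',
      ReachIn E (C.part {v | v.2 = j}) (C.mark (i, j)) (C.mark (i', j)) := by
    intro E hE j i i'
    have := (hE.reach_iterate (P := {v | v.2 = j}) (fun u hu => by simpa [hCn] using hu)
      (v := (i, j)) rfl (i' - i).val).2
    rwa [hCit, ZMod.natCast_zmod_val, add_sub_cancel] at this
  refine exists_eulerianizable hn R C (fun i : ZMod m => (i, 0)) (fun j : ZMod m => (0, j))
    (fun i => R.part {v | v.1 = i}) (fun j => C.part {v | v.2 = j})
    (R.exists_disjoint_part_fiber hm Prod.fst) (C.exists_disjoint_part_fiber hm Prod.snd)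
    (fun i => l_subset_part (by simp) (R.l (i, 0)).last_mem)
    (fun E hR hC i j => ⟨?_, ?_⟩) (fun E hR v => ⟨v.1, ?_, ?_⟩) (fun E hC v => ⟨v.2, ?_, ?_⟩)
  · have hnext : R.next (i, j - 1) = (i, j) := by simp [hRn]
    refine (((hrow E hR i 0 (j - 1)).mono Set.subset_union_left).trans
      (hR.reach_cross_part hC (P := {v | v.1 = i}) (Q := {v | v.2 = j}) (j := (i, j)) rfl
        (by simp [hnext]) rfl ?_)).trans
      ((hcol E hC j i 0).mono Set.subset_union_right)
    rw [hnext]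
    exact hx _
  · have hnext : C.next (i - 1, j) = (i, j) := by simp [hCn]
    rw [Set.union_comm]
    refine (((hcol E hC j 0 (i - 1)).mono Set.subset_union_left).trans
      (hC.reach_cross_part hR (P := {v | v.2 = j}) (Q := {v | v.1 = i}) (j := (i, j)) rfl
        (by simp [hnext]) rfl ?_)).trans
      ((hrow E hR i j 0).mono Set.subset_union_right)
    rw [hnext, Set.inter_comm]
    exact hx _
  · exact (hrow E hR v.1 v.2 0).mono (Set.subset_univ _)
  · exact (hrow E hR v.1 0 v.2).mono (Set.subset_univ _)
  · exact (hcol E hC v.2 v.1 0).mono (Set.subset_univ _)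
  · exact (hcol E hC v.2 0 v.1).mono (Set.subset_univ _)

/-- Disjoint intervals of a path, joined up by disjoint paths, form a ring. -/
theorem exists_of_intervals (q : DPath A) (nx : Equiv.Perm ι) (α β : ι → ℕ)
    (hαβ : ∀ v, α v ≤ β v) (hβ : ∀ v, β v ≤ q.len)
    (hsep : ∀ u v, u ≠ v → β u < α v ∨ β v < α u) (r : ι → DPath A)
    (hr : ∀ v, (r v).first = q.pt (β v)) (hr' : ∀ v, (r v).last = q.pt (α (nx v)))
    (hdisj : Pairwise fun i j => Disjoint (r i).verts (r j).verts) :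
    ∃ R : LinkRing A ι, R.next = nx ∧
      ∀ v t, α v ≤ t → t ≤ β v → q.pt t ∈ (R.l v).verts := by
  refine ⟨⟨fun v => q.slice (α v) (β v) (hαβ v) (hβ v), r, nx, fun v => ?_, fun v => ?_, ?_,
    hdisj⟩, rfl, fun v t h1 h2 => (DPath.mem_slice (hαβ v) (hβ v)).2 ⟨t, h1, h2, rfl⟩⟩
  · rw [DPath.slice_last, hr]
  · rw [DPath.slice_first, hr']
  · intro u v huv
    rw [Set.disjoint_left]
    intro x hxu hxv
    obtain ⟨s, hs1, hs2, rfl⟩ := (DPath.mem_slice (hαβ u) (hβ u)).1 hxu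
    obtain ⟨t, ht1, ht2, hst⟩ := (DPath.mem_slice (hαβ v) (hβ v)).1 hxv
    have h1 := hβ u
    have h2 := hβ v
    have := q.inj _ (by omega) _ (by omega) hst
    rcases hsep u v huv with h | h <;> omega

end LinkRing

/-- For every `n ≥ 1` there is `N` such that every finite digraph with a
haven of order at least `N` has a `6`-eulerianizable subdigraph with a haven of order at
least `n`. -/
theorem haven_gives_eulerianizable_subdigraph (n : ℕ) (hn : 0 < n) :
    ∃ N : ℕ, 0 < N ∧
      ∀ (V : Type) [Fintype V] [DecidableEq V] (A : V → V → Prop),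
        (∃ w, N ≤ w ∧ HasHaven A w) →
        ∃ (S : Set V) (A' : V → V → Prop),
          IsSubdigraph A S A' ∧ Eulerianizable A' S 6 ∧
          ∃ w, n ≤ w ∧ HasHavenOn A' S w := by
  obtain ⟨m, hm⟩ : ∃ m, m = 4 * n := ⟨_, rfl⟩
  have : NeZero m := ⟨by omega⟩
  let ι := ZMod m × ZMod m
  obtain ⟨b₀, hb₀⟩ := exists_biclique_or_transversal m (Fintype.card (ι × Bool))
  obtain ⟨b, hb⟩ : ∃ b, b = b₀ + 1 := ⟨_, rfl⟩
  obtain ⟨M, hM⟩ : ∃ M, M = Fintype.card ι * (2 * b) := ⟨_, rfl⟩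
  have hMpos : 0 < M := by
    rw [hM]
    exact Nat.mul_pos Fintype.card_pos (by omega)
  refine ⟨2 * (2 * M * (M + 1)), by positivity, ?_⟩
  rintro V _ _ A ⟨w, hw, B, hB⟩
  obtain ⟨q, pos, hpos, hlen, hlink⟩ := hB.exists_linked_path hMpos hw
  have hposle : ∀ i j, i ≤ j → j < M → pos i ≤ pos j := fun i j hij hj => by
    rcases hij.eq_or_lt with rfl | hij
    · exact le_rfl
    · exact (hpos i j hij hj).le
  obtain ⟨base, hbase, hsep⟩ : ∃ base : ι → ℕ, (∀ v, base v + 2 * b ≤ M) ∧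
      ∀ u v, u ≠ v → base u + 2 * b ≤ base v ∨ base v + 2 * b ≤ base u := by
    have key : ∀ s t : ℕ, s < t → s * (2 * b) + 2 * b ≤ t * (2 * b) := fun s t hst => by
      rw [← Nat.succ_mul]
      exact Nat.mul_le_mul_right _ hst
    refine ⟨fun v => Fintype.equivFin ι v * (2 * b), fun v => ?_, fun u v huv => ?_⟩
    · rw [hM]
      exact key _ _ (Fintype.equivFin ι v).2
    · rcases Nat.lt_or_gt_of_ne (fun h => huv ((Fintype.equivFin ι).injective (Fin.ext h)))
        with h | h
      · exact Or.inl (key _ _ h)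
      · exact Or.inr (key _ _ h)
  let nx : Bool → Equiv.Perm ι := fun c =>
    if c then (Equiv.refl _).prodCongr (Equiv.addRight 1) else
      (Equiv.addRight 1).prodCongr (Equiv.refl _)
  have hlinks : ∀ e : ι × Bool, ∃ (p : Fin b → DPath A) (σ : Equiv.Perm (Fin b)),
      (∀ t, (p t).first = q.pt (pos (base e.1 + b + t))) ∧
      (∀ t, (p t).last = q.pt (pos (base (nx e.2 e.1) + σ t))) ∧
      Pairwise fun i j => Disjoint (p i).verts (p j).verts := by
    intro e
    have h1 := hbase e.1
    have h2 := hbase (nx e.2 e.1)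
    exact hlink (fun t : Fin b => base e.1 + b + t) (fun t => base (nx e.2 e.1) + t)
      (fun s t h => Fin.ext (by simpa using h)) (fun s t h => Fin.ext (by simpa using h))
      (fun t => by have := t.2; omega) (fun t => by have := t.2; omega)
  choose p σ hfirst hlast hdisj using hlinks
  have : Nonempty (Fin b) := ⟨⟨0, by omega⟩⟩
  rcases hb₀ (Finset.univ : Finset (ι × Bool)) (fun e => {e} ×ˢ (Finset.univ : Finset (Fin b)))
    (fun x y => ((p x.1 x.2).verts ∩ (p y.1 y.2).verts).Nonempty)
    (fun x y h => Set.inter_comm _ _ ▸ h) Finset.card_univ (fun e _ => by simp; omega) with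
    ⟨e, -, f, -, -, U, hU, U', hU', hUc, hUc', hcross⟩ | ⟨x, hx, hind⟩
  · have ring : ∀ (e : ι × Bool) (U : Finset ((ι × Bool) × Fin b)),
        U ⊆ {e} ×ˢ Finset.univ → U.card = m →
        ∃ R : LinkRing A (Fin m), ∀ i, ∃ y ∈ U, R.l i = p y.1 y.2 := by
      intro e U hU hUc
      let g : Fin m → Fin b := fun i => ((U.equivFinOfCardEq hUc).symm i).1.2
      have hfst : ∀ y ∈ U, y.1 = e := fun y hy => by simpa using (Finset.mem_product.1 (hU hy)).1
      have hg : Function.Injective g := fun i j hij => by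
        refine (U.equivFinOfCardEq hUc).symm.injective (Subtype.ext (Prod.ext ?_ hij))
        rw [hfst _ (Subtype.mem _), hfst _ (Subtype.mem _)]
      have h1 := hbase e.1
      have h2 := hbase (nx e.2 e.1)
      obtain ⟨r, τ, hr, hr', hrd⟩ := hlink
        (fun i => base (nx e.2 e.1) + σ e (g i)) (fun i => base e.1 + b + g i)
        (fun i j h => hg ((σ e).injective (Fin.ext (by simpa using h))))
        (fun i j h => hg (Fin.ext (by simpa using h)))
        (fun i => by have := (σ e (g i)).2; omega) (fun i => by have := (g i).2; omega)
      refine ⟨⟨fun i => p e (g i), r, τ, fun i => by rw [hlast, hr], fun i => by rw [hr', hfirst],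
        fun i j hij => hdisj e (fun h => hij (hg h)), hrd⟩, fun i => ?_⟩
      refine ⟨_, ((U.equivFinOfCardEq hUc).symm i).2, ?_⟩
      rw [hfst _ (Subtype.mem _)]
    obtain ⟨R, hR⟩ := ring e U hU hUc
    obtain ⟨C, hC⟩ := ring f U' hU' hUc'
    refine LinkRing.exists_of_crossing hn hm.ge R C fun i j => ?_
    obtain ⟨y, hy, hRy⟩ := hR i
    obtain ⟨z, hz, hCz⟩ := hC j
    rw [hRy, hCz]
    exact hcross y hy z hz
  · have hx1 : ∀ e, (x e).1 = e := fun e => by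
      simpa using (Finset.mem_product.1 (hx e (Finset.mem_univ e))).1
    have ring : ∀ c : Bool, ∃ R : LinkRing A ι, R.next = nx c ∧
        ∀ v, q.pt (pos (base v + b)) ∈ (R.l v).verts := by
      intro c
      let s : ι → Fin b := fun v => (x (v, c)).2
      let s' : ι → Fin b := fun v => σ ((nx c).symm v, c) (s ((nx c).symm v))
      obtain ⟨R, hR, hmem⟩ := LinkRing.exists_of_intervals q (nx c)
        (fun v => pos (base v + s' v)) (fun v => pos (base v + b + s v))
        (fun v => hposle _ _ (by have := (s' v).2; omega)
          (by have := (s v).2; have := hbase v; omega))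
        (fun v => hlen _ (by have := (s v).2; have := hbase v; omega))
        (fun u v huv => by
          have h1 := (s u).2
          have h2 := (s v).2
          have h3 := hbase u
          have h4 := hbase v
          rcases hsep u v huv with h | h
          · exact Or.inl (hpos _ _ (by omega) (by have := (s' v).2; omega))
          · exact Or.inr (hpos _ _ (by omega) (by have := (s' u).2; omega)))
        (fun v => p (v, c) (s v)) (fun v => hfirst _ _)
        (fun v => by simp only [hlast, s', Equiv.symm_apply_apply])
        (fun u v huv => by
          have := hind (u, c) (Finset.mem_univ _) (v, c) (Finset.mem_univ _)
            (fun h => huv (congrArg Prod.fst h))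
          rw [hx1, hx1] at this
          exact Set.disjoint_iff_inter_eq_empty.2 (Set.not_nonempty_iff_eq_empty.1 this))
      exact ⟨R, hR, fun v => hmem v _
        (hposle _ _ (by have := (s' v).2; omega) (by have := hbase v; omega))
        (hposle _ _ (by omega) (by have := (s v).2; have := hbase v; omega))⟩
    obtain ⟨R, hR, hRm⟩ := ring true
    obtain ⟨C, hC, hCm⟩ := ring false
    exact LinkRing.exists_of_grid hn hm.ge R C (fun v => by rw [hR]; rfl)
      (fun v => by rw [hC]; rfl) fun v => ⟨_, hRm v, hCm v⟩
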